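/- arXiv:1207.6851 — 3 statements merged into one kernel-verified Lean document; each statement's English description precedes it below -/
import Mathlib

section
/- For every n ≥ 1 and every j with 1 ≤ j ≤ n, the coefficient function K n j equals the sum, over all strictly increasing j-tuples of integers 1 ≤ k₁ < k₂ < ⋯ < k_j ≤ n, of the functions r^{n−k_j} · F(k₁,…,k_j), where F is defined recursively on tuples by F(k₁) = Ψ(r^{k₁−1}) and F(k₁,…,k_m) = Ψ( r^{k_m−k_{m−1}−1} · F(k₁,…,k_{m−1}) ) for m ≥ 2, and r^m denotes the pointwise m-th power of r. -/
/-- The first-order differential operator `Ψ y = r·y' + s·y`. -/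
noncomputable def Psi (r s : ℝ → ℝ) (y : ℝ → ℝ) : ℝ → ℝ :=
  fun x => r x * deriv y x + s x * y x


/-- The coefficient functions `K n j` of the iterative equation, defined by the
recurrence `K 0 0 = 1`, `K m j = 0` for `j > m`,
`K n j = r · K (n-1) j + Ψ (K (n-1) (j-1))` for `n ≥ 1`, `1 ≤ j ≤ n`,
and `K n 0 = r · K (n-1) 0` for `n ≥ 1`. -/
noncomputable def K (r s : ℝ → ℝ) : ℕ → ℕ → ℝ → ℝ
  | 0, 0 => fun _ => 1
  | 0, _ + 1 => fun _ => 0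
  | n + 1, 0 => fun x => r x * K r s n 0 x
  | n + 1, j + 1 => fun x => r x * K r s n (j + 1) x + Psi r s (K r s n j) x


/-- `F` applied to the list `[k_m, k_{m-1}, …, k₁]` (indices in decreasing order)
is the function defined recursively by `F [k₁] = Ψ(r^{k₁-1})` and
`F [k_m, …, k₁] = Ψ( r^{k_m - k_{m-1} - 1} · F [k_{m-1}, …, k₁] )`. -/
noncomputable def F (r s : ℝ → ℝ) : List ℕ → ℝ → ℝ
  | [] => fun _ => 1
  | [k] => Psi r s fun x => r x ^ (k - 1)
  | k :: k' :: t => Psi r s fun x => r x ^ (k - k' - 1) * F r s (k' :: t) x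

/-- The summand `r^{n - k_j} · F(k₁, …, k_j)` attached to `S = {k₁ < ⋯ < k_j}`. -/
noncomputable def summand (r s : ℝ → ℝ) (n : ℕ) (S : Finset ℕ) : ℝ → ℝ :=
  fun x => r x ^ (n - (S.sort (· ≤ ·)).reverse.headD 0) * F r s (S.sort (· ≤ ·)).reverse x

theorem Psi_sum {ι : Type*} (r s : ℝ → ℝ) (T : Finset ι) {f : ι → ℝ → ℝ}
    (hf : ∀ i ∈ T, Differentiable ℝ (f i)) :
    Psi r s (∑ i ∈ T, f i) = ∑ i ∈ T, Psi r s (f i) := by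
  funext x
  simp only [Psi, Finset.sum_apply, deriv_sum fun i hi => hf i hi x, Finset.mul_sum,
    Finset.sum_add_distrib]

theorem contDiff_Psi {r s y : ℝ → ℝ} (hr : ContDiff ℝ (⊤ : ℕ∞) r)
    (hs : ContDiff ℝ (⊤ : ℕ∞) s) (hy : ContDiff ℝ (⊤ : ℕ∞) y) :
    ContDiff ℝ (⊤ : ℕ∞) (Psi r s y) :=
  (hr.mul (contDiff_infty_iff_deriv.mp hy).2).add (hs.mul hy)

theorem F_cons (r s : ℝ → ℝ) (k : ℕ) (l : List ℕ) :
    F r s (k :: l) = Psi r s fun x => r x ^ (k - l.headD 0 - 1) * F r s l x := by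
  cases l <;> simp [F]

theorem contDiff_F {r s : ℝ → ℝ} (hr : ContDiff ℝ (⊤ : ℕ∞) r)
    (hs : ContDiff ℝ (⊤ : ℕ∞) s) (l : List ℕ) : ContDiff ℝ (⊤ : ℕ∞) (F r s l) := by
  induction l with
  | nil => exact contDiff_const
  | cons k l ih =>
    rw [F_cons]
    exact contDiff_Psi hr hs ((hr.pow _).mul ih)

theorem contDiff_summand {r s : ℝ → ℝ} (hr : ContDiff ℝ (⊤ : ℕ∞) r)
    (hs : ContDiff ℝ (⊤ : ℕ∞) s) (n : ℕ) (S : Finset ℕ) :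
    ContDiff ℝ (⊤ : ℕ∞) (summand r s n S) :=
  (hr.pow _).mul (contDiff_F hr hs _)

theorem sort_insert_of_forall_lt {S : Finset ℕ} {a : ℕ} (h : ∀ b ∈ S, b < a) :
    (insert a S).sort (· ≤ ·) = S.sort (· ≤ ·) ++ [a] := by
  have ha : a ∉ S := fun haS => lt_irrefl a (h a haS)
  have hnodup : (S.sort (· ≤ ·) ++ [a]).Nodup := by
    simp [List.nodup_append, ha]
  have hsorted : (S.sort (· ≤ ·) ++ [a]).Pairwise (· ≤ ·) := by
    simpa [List.pairwise_append] using fun b hb => (h b hb).le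
  rw [← (List.toFinset_sort (· ≤ ·) hnodup).2 hsorted]
  congr 1
  ext b
  simp

theorem summand_succ (r s : ℝ → ℝ) {n : ℕ} {S : Finset ℕ} (h : ∀ b ∈ S, b ≤ n) :
    summand r s (n + 1) S = r * summand r s n S := by
  have hle : (S.sort (· ≤ ·)).reverse.headD 0 ≤ n := by
    cases hl : (S.sort (· ≤ ·)).reverse with
    | nil => simp
    | cons b l =>
      refine h b ((Finset.mem_sort (· ≤ ·)).1 (List.mem_reverse.1 ?_))
      simp [hl]
  funext x
  simp only [summand, Pi.mul_apply, Nat.succ_sub hle, Nat.succ_eq_add_one, pow_succ]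
  ring

theorem summand_succ_insert (r s : ℝ → ℝ) {n : ℕ} {S : Finset ℕ} (h : ∀ b ∈ S, b ≤ n) :
    summand r s (n + 1) (insert (n + 1) S) = Psi r s (summand r s n S) := by
  funext x
  rw [summand, sort_insert_of_forall_lt fun b hb => Nat.lt_succ_of_le (h b hb)]
  simp only [List.reverse_append, List.reverse_singleton, List.singleton_append, List.headD_cons,
    Nat.sub_self, pow_zero, one_mul, F_cons, Nat.sub_right_comm _ _ 1]
  rfl

theorem K_eq_sum {r s : ℝ → ℝ} (hr : ContDiff ℝ (⊤ : ℕ∞) r) (hs : ContDiff ℝ (⊤ : ℕ∞) s)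
    (n j : ℕ) :
    K r s n j = ∑ S ∈ (Finset.Icc 1 n).powersetCard j, summand r s n S := by
  have hle {n j : ℕ} {S : Finset ℕ} (hS : S ∈ (Finset.Icc 1 n).powersetCard j) :
      ∀ b ∈ S, b ≤ n := fun b hb =>
    (Finset.mem_Icc.1 ((Finset.mem_powersetCard.1 hS).1 hb)).2
  induction n generalizing j with
  | zero =>
    cases j with
    | zero => funext x; simp [K, summand, F]
    | succ j => rw [Finset.powersetCard_eq_empty.2 (by simp)]; rfl
  | succ n ih =>
    have hmul (j : ℕ) : ∑ S ∈ (Finset.Icc 1 n).powersetCard j, summand r s (n + 1) S =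
        r * K r s n j := by
      rw [ih, Finset.mul_sum]
      exact Finset.sum_congr rfl fun S hS => summand_succ r s (hle hS)
    cases j with
    | zero =>
      rw [Finset.powersetCard_zero, ← Finset.powersetCard_zero (Finset.Icc 1 n), hmul]
      rfl
    | succ j =>
      have hnot : n + 1 ∉ Finset.Icc 1 n := by simp
      have hnotMem {i : ℕ} {S : Finset ℕ} (hS : S ∈ (Finset.Icc 1 n).powersetCard i) :
          n + 1 ∉ S := fun hmem => hnot ((Finset.mem_powersetCard.1 hS).1 hmem)
      rw [← Finset.insert_Icc_right_eq_Icc_add_one (by omega),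
        Finset.powersetCard_succ_insert hnot, Finset.sum_union, Finset.sum_image, hmul]
      · rw [Finset.sum_congr rfl fun S hS => summand_succ_insert r s (hle hS), ← Psi_sum, ← ih]
        · rfl
        · exact fun S _ => (contDiff_summand hr hs n S).differentiable (by simp)
      · intro S hS T hT hST
        rw [← Finset.erase_insert (hnotMem hS), ← Finset.erase_insert (hnotMem hT)]
        exact congrArg (fun U => U.erase (n + 1)) hST
      · refine Finset.disjoint_left.2 fun S hS hS' => hnotMem hS ?_
        obtain ⟨T, -, rfl⟩ := Finset.mem_image.1 hS'
        exact Finset.mem_insert_self _ _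

/-- for `n ≥ 1` and `1 ≤ j ≤ n`, `K n j` equals the sum over all strictly
increasing `j`-tuples `1 ≤ k₁ < k₂ < ⋯ < k_j ≤ n` (identified with the `j`-element
subsets `S` of `{1, …, n}`, listed here in decreasing order) of
`r^{n - k_j} · F(k₁, …, k_j)`. -/
theorem coeff_K_n_j_sum (r s : ℝ → ℝ) (hr : ContDiff ℝ (⊤ : ℕ∞) r) (hs : ContDiff ℝ (⊤ : ℕ∞) s)
    (n j : ℕ) (hn : 1 ≤ n) (hj : 1 ≤ j) (hjn : j ≤ n) :
    K r s n j =
      ∑ S ∈ (Finset.Icc 1 n).powersetCard j,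
        fun x => r x ^ (n - (S.sort (· ≤ ·)).reverse.headD 0) *
          F r s (S.sort (· ≤ ·)).reverse x := by
  rw [K_eq_sum hr hs]
  rfl
end

section
/- Let n ≥ 1 and suppose r(x) ≠ 0 for all x. Then the coefficient function K n 1 is identically zero if and only if s = −((n−1)/2)·r', where r' is the derivative of r. -/
theorem K_zero_right (r s : ℝ → ℝ) (n : ℕ) : K r s n 0 = fun x => r x ^ n := by
  induction n with
  | zero => simp [K]
  | succ n ih =>
    funext x
    simp only [K, ih, pow_succ']

theorem K_succ_one {r : ℝ → ℝ} (hr : Differentiable ℝ r) (s : ℝ → ℝ) (n : ℕ) (x : ℝ) :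
    K r s (n + 1) 1 x = (n + 1) * r x ^ n * (s x + n / 2 * deriv r x) := by
  induction n with
  | zero => simp [K, Psi]
  | succ n ih =>
    have hd : deriv (fun x => r x ^ (n + 1)) x = (n + 1) * r x ^ n * deriv r x := by
      simpa using ((hr x).hasDerivAt.fun_pow (n + 1)).deriv
    rw [K]
    simp only [zero_add, ih, K_zero_right, Psi, hd]
    push_cast
    ring

/-- for `n ≥ 1` and `r` nonvanishing, `K n 1` is identically zero
if and only if `s = −((n−1)/2)·r'`. -/
theorem coeff_K_n_one_eq_zero_iff (r s : ℝ → ℝ) (hr : ContDiff ℝ (⊤ : ℕ∞) r) (hs : ContDiff ℝ (⊤ : ℕ∞) s)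
    (hr0 : ∀ x, r x ≠ 0) (n : ℕ) (hn : 1 ≤ n) :
    K r s n 1 = 0 ↔ s = fun x => -(((n : ℝ) - 1) / 2) * deriv r x := by
  obtain ⟨m, rfl⟩ : ∃ m, n = m + 1 := ⟨n - 1, by omega⟩
  have hd : Differentiable ℝ r := hr.differentiable (by simp)
  have hm : (m : ℝ) + 1 ≠ 0 := by positivity
  simp only [funext_iff, Pi.zero_apply, K_succ_one hd, mul_eq_zero, hm, pow_ne_zero m (hr0 _),
    false_or]
  refine forall_congr' fun x => ?_
  push_cast
  rw [add_eq_zero_iff_eq_neg, add_sub_cancel_right, neg_mul]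
end

section
/- Let r : ℝ → ℝ be smooth with r(x) ≠ 0 for all x, set s = −(3/2)·r', and define a = (5/2)·((r')² − 2·r·r'') / r². Then for every smooth function y : ℝ → ℝ, the fourth iterate of Ψ satisfies Ψ⁴ y = r⁴ · ( y'''' + a·y'' + a'·y' + ( (3/10)·a'' + (9/100)·a² )·y ). In other words, every fourth-order linear iterative equation in reduced normal form has the form y'''' + a y'' + a' y' + ((3/10) a'' + (9/100) a²) y = 0. -/
theorem ContDiff.hasDerivAt_iteratedDeriv {f : ℝ → ℝ} (hf : ContDiff ℝ (⊤ : ℕ∞) f)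
    (n : ℕ) (x : ℝ) :
    HasDerivAt (iteratedDeriv n f) (iteratedDeriv (n + 1) f x) x := by
  rw [iteratedDeriv_succ]
  exact (hf.differentiable_iteratedDeriv n (by exact_mod_cast ENat.natCast_lt_top n) x).hasDerivAt

theorem Psi_eq_of_hasDerivAt {r s f f' : ℝ → ℝ} (hf : ∀ x, HasDerivAt f (f' x) x) :
    Psi r s f = fun x => r x * f' x + s x * f x := by
  funext x
  rw [Psi, (hf x).deriv]

/-- with `r` smooth and nonvanishing, `s = −(3/2)·r'`, and
`a = (5/2)·((r')² − 2·r·r'')/r²`, for every smooth `y` one has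
`Ψ⁴ y = r⁴·(y'''' + a·y'' + a'·y' + ((3/10)·a'' + (9/100)·a²)·y)`. -/
theorem fourth_order_normal_form (r : ℝ → ℝ) (hr : ContDiff ℝ (⊤ : ℕ∞) r) (hr0 : ∀ x, r x ≠ 0)
    (s : ℝ → ℝ) (hs : s = fun x => -(3 / 2) * deriv r x)
    (a : ℝ → ℝ)
    (ha : a = fun x =>
      (5 / 2) * ((deriv r x) ^ 2 - 2 * r x * iteratedDeriv 2 r x) / r x ^ 2)
    (y : ℝ → ℝ) (hy : ContDiff ℝ (⊤ : ℕ∞) y) :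
    (Psi r s)^[4] y =
      fun x => r x ^ 4 *
        (iteratedDeriv 4 y x + a x * iteratedDeriv 2 y x + deriv a x * deriv y x +
          ((3 / 10) * iteratedDeriv 2 a x + (9 / 100) * a x ^ 2) * y x) := by
  have hR := hr.hasDerivAt_iteratedDeriv
  have hY := hy.hasDerivAt_iteratedDeriv
  have hr1 : deriv r = iteratedDeriv 1 r := iteratedDeriv_one.symm
  have hy1 : deriv y = iteratedDeriv 1 y := iteratedDeriv_one.symm
  have hR0 : ∀ x, HasDerivAt r (iteratedDeriv 1 r x) x := by simpa using hR 0
  have hY0 : ∀ x, HasDerivAt y (iteratedDeriv 1 y x) x := by simpa using hY 0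
  rw [hr1] at hs ha
  rw [hy1]
  have hR1 := hR 1
  have hR2 := hR 2
  have hR3 := hR 3
  have hY1 := hY 1
  have hY2 := hY 2
  have hY3 := hY 3
  norm_num only at hR1 hR2 hR3 hY1 hY2 hY3
  clear hR hY
  generalize iteratedDeriv 1 r = R1 at *
  generalize iteratedDeriv 2 r = R2 at *
  generalize iteratedDeriv 3 r = R3 at *
  generalize iteratedDeriv 4 r = R4 at *
  generalize iteratedDeriv 1 y = Y1 at *
  generalize iteratedDeriv 2 y = Y2 at *
  generalize iteratedDeriv 3 y = Y3 at *
  generalize iteratedDeriv 4 y = Y4 at *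
  have da : deriv a = fun x =>
      5 * (2 * r x * R1 x * R2 x - r x ^ 2 * R3 x - R1 x ^ 3) / r x ^ 3 := by
    funext x
    have h := ((((hR1 x).pow 2).sub (((hR0 x).const_mul 2).mul (hR2 x))).const_mul (5 / 2)).div
      ((hR0 x).pow 2) (pow_ne_zero 2 (hr0 x))
    rw [ha]
    refine (h.congr_deriv ?_).deriv
    have := hr0 x
    simp only [Pi.pow_apply, Pi.sub_apply, Pi.mul_apply]
    field_simp
    ring
  have dda : iteratedDeriv 2 a = fun x =>
      5 * ((2 * r x * R2 x ^ 2 - r x ^ 2 * R4 x - R1 x ^ 2 * R2 x) * r x -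
        3 * (2 * r x * R1 x * R2 x - r x ^ 2 * R3 x - R1 x ^ 3) * R1 x) / r x ^ 4 := by
    funext x
    have h := (((((((hR0 x).const_mul 2).mul (hR1 x)).mul (hR2 x)).sub
      (((hR0 x).pow 2).mul (hR3 x))).sub ((hR1 x).pow 3)).const_mul 5).div
      ((hR0 x).pow 3) (pow_ne_zero 3 (hr0 x))
    rw [iteratedDeriv_succ, iteratedDeriv_one, da]
    refine (h.congr_deriv ?_).deriv
    have := hr0 x
    simp only [Pi.pow_apply, Pi.sub_apply, Pi.mul_apply]
    field_simp
    ring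
  have psi1 : Psi r s y = fun x => r x * Y1 x - 3 / 2 * R1 x * y x := by
    rw [Psi_eq_of_hasDerivAt hY0, hs]
    funext x
    ring
  have psi2 : Psi r s (fun x => r x * Y1 x - 3 / 2 * R1 x * y x) = fun x =>
      r x ^ 2 * Y2 x - 2 * r x * R1 x * Y1 x +
        (9 / 4 * R1 x ^ 2 - 3 / 2 * r x * R2 x) * y x := by
    refine (Psi_eq_of_hasDerivAt fun x =>
      ((hR0 x).mul (hY1 x)).sub (((hR1 x).const_mul (3 / 2)).mul (hY0 x))).trans ?_
    rw [hs]
    funext x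
    simp only [Pi.sub_apply, Pi.mul_apply]
    ring
  have psi3 : Psi r s (fun x => r x ^ 2 * Y2 x - 2 * r x * R1 x * Y1 x +
        (9 / 4 * R1 x ^ 2 - 3 / 2 * r x * R2 x) * y x) = fun x =>
      r x ^ 3 * Y3 x - 3 / 2 * r x ^ 2 * R1 x * Y2 x +
        (13 / 4 * r x * R1 x ^ 2 - 7 / 2 * r x ^ 2 * R2 x) * Y1 x +
        (21 / 4 * r x * R1 x * R2 x - 3 / 2 * r x ^ 2 * R3 x - 27 / 8 * R1 x ^ 3) * y x := by
    refine (Psi_eq_of_hasDerivAt fun x =>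
      ((((hR0 x).pow 2).mul (hY2 x)).sub ((((hR0 x).const_mul 2).mul (hR1 x)).mul (hY1 x))).add
        (((((hR1 x).pow 2).const_mul (9 / 4)).sub
          (((hR0 x).const_mul (3 / 2)).mul (hR2 x))).mul (hY0 x))).trans ?_
    rw [hs]
    funext x
    simp only [Pi.add_apply, Pi.pow_apply, Pi.sub_apply, Pi.mul_apply]
    ring
  simp only [Function.iterate_succ_apply, Function.iterate_zero_apply]
  rw [psi1, psi2, psi3]
  refine (Psi_eq_of_hasDerivAt fun x =>
    (((((hR0 x).pow 3).mul (hY3 x)).sub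
      (((((hR0 x).pow 2).const_mul (3 / 2)).mul (hR1 x)).mul (hY2 x))).add
      (((((hR0 x).const_mul (13 / 4)).mul ((hR1 x).pow 2)).sub
        ((((hR0 x).pow 2).const_mul (7 / 2)).mul (hR2 x))).mul (hY1 x))).add
      ((((((hR0 x).const_mul (21 / 4)).mul (hR1 x)).mul (hR2 x)).sub
        ((((hR0 x).pow 2).const_mul (3 / 2)).mul (hR3 x))).sub
        (((hR1 x).pow 3).const_mul (27 / 8)) |>.mul (hY0 x))).trans ?_
  rw [da, dda, ha, hs]
  funext x
  have := hr0 x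
  simp only [Pi.add_apply, Pi.pow_apply, Pi.sub_apply, Pi.mul_apply]
  field_simp
  ring
end
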